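/- arXiv:2205.03040 — 3 statements merged into one kernel-verified Lean document; each statement's English description precedes it below -/
import Mathlib

section
/- Let R, B, T, i be natural numbers with 1 ≤ i ≤ R and 1 ≤ B. Then, in the rationals, the product of the two check-passing probabilities simplifies to a single expression: ( C(R·B + T − i·B, T) / C(R·B + T, T) ) · ( C(R, i) · (i·B)! · (R·B − i·B)! / (R·B)! ) = C(R, i) / C(R·B + T, i·B), where C(n,k) denotes the binomial coefficient n choose k. -/
/-- A uniformly random `T`-subset of `n + T` objects avoids `a` fixed ones, and an independent uniformly
random `a`-subset of `n` objects is a fixed one, with joint probability `1 / C(n + T, a)`. -/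
theorem Nat.choose_div_choose_mul_factorial_div_factorial {n a : ℕ} (T : ℕ) (h : a ≤ n) :
    ((n + T - a).choose T : ℚ) / ((n + T).choose T : ℚ) *
      ((a.factorial : ℚ) * ((n - a).factorial : ℚ) / (n.factorial : ℚ)) =
      1 / ((n + T).choose a : ℚ) := by
  obtain ⟨m, rfl⟩ := Nat.exists_eq_add_of_le h
  have hsub : a + m + T - a = m + T := by omega
  rw [Nat.cast_choose ℚ (show a ≤ a + m + T by omega), hsub, Nat.add_sub_cancel_left,
    Nat.cast_choose ℚ (Nat.le_add_left T m), Nat.cast_choose ℚ (Nat.le_add_left T (a + m)),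
    Nat.add_sub_cancel, Nat.add_sub_cancel]
  have hfac (k : ℕ) : (k.factorial : ℚ) ≠ 0 := Nat.cast_ne_zero.mpr k.factorial_ne_zero
  have := hfac a
  have := hfac m
  have := hfac T
  have := hfac (a + m)
  have := hfac (m + T)
  have := hfac (a + m + T)
  field_simp

/-- In the Fusion mix-and-check method, the product of the
probability of passing the public-sample accuracy check,
`Pr[E_T] = C(R·B+T−i·B, T)/C(R·B+T, T)`, and the probability of passing the
copy-consistency check, `Pr[E_B] = C(R,i)·(i·B)!·(R·B−i·B)!/(R·B)!`,
equals `C(R, i) / C(R·B + T, i·B)` in `ℚ`. -/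
theorem fusion_pr_success_eq (R B T i : ℕ) (hi1 : 1 ≤ i) (hiR : i ≤ R) (hB : 1 ≤ B) :
    ((Nat.choose (R * B + T - i * B) T : ℚ) / (Nat.choose (R * B + T) T : ℚ)) *
      ((Nat.choose R i : ℚ) * (Nat.factorial (i * B) : ℚ) *
          (Nat.factorial (R * B - i * B) : ℚ) / (Nat.factorial (R * B) : ℚ)) =
      (Nat.choose R i : ℚ) / (Nat.choose (R * B + T) (i * B) : ℚ) := by
  have h := Nat.choose_div_choose_mul_factorial_div_factorial T (Nat.mul_le_mul_right B hiR)
  rw [mul_assoc (R.choose i : ℚ), mul_div_assoc, mul_left_comm, h, mul_one_div]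
end

section
/- (Claim 1) Let R, B, T, i be natural numbers with 1 ≤ i ≤ R, 1 ≤ B, and B ≤ T. Then, in the rationals, C(R, i) / C(R·B + T, i·B) ≤ R / C(R·B + T, B), where C(n,k) denotes the binomial coefficient n choose k. Equivalently, C(R, i) · C(R·B + T, B) ≤ R · C(R·B + T, i·B). -/
/-- Binomial coefficients increase towards the middle: `C(n, k) ≤ C(n, m)` whenever
`k ≤ m ≤ n - k`. -/
theorem choose_le_choose_of_add_le {n k m : ℕ} (hkm : k ≤ m) (h : k + m ≤ n) :
    n.choose k ≤ n.choose m := by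
  have h1 := Nat.choose_mul (n := n) hkm
  have h2 : m.choose k ≤ (n - k).choose (m - k) := by
    rw [← Nat.choose_symm hkm]
    exact Nat.choose_le_choose _ (by omega)
  have hpos : 0 < m.choose k := Nat.choose_pos hkm
  refine Nat.le_of_mul_le_mul_right ?_ hpos
  rw [h1]
  exact Nat.mul_le_mul_left _ h2

theorem mul_choose_mul_le_mul_choose_mul {a b B : ℕ} (hB : B ≠ 0) (hab : a ≤ b) :
    b * (a * B).choose B ≤ a * (b * B).choose B := by
  rw [Nat.choose_mul_right hB, Nat.choose_mul_right hB, mul_left_comm b a]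
  gcongr

/-- In the lower half of the range, `C(R, i) / C(N, i * B)` decreases in `i`. -/
theorem choose_succ_mul_choose_le {R B N i : ℕ} (hB : B ≠ 0) (hi : 2 * i ≤ R)
    (hN : (R + 1) * B ≤ N) :
    R.choose (i + 1) * N.choose (i * B) ≤ R.choose i * N.choose ((i + 1) * B) := by
  have hle : i * B ≤ (i + 1) * B := Nat.mul_le_mul_right _ (Nat.le_succ i)
  have hsub : (i + 1) * B - i * B = B := by rw [Nat.succ_mul]; omega
  have h1 := Nat.choose_mul (n := N) hle
  rw [← Nat.choose_symm hle, hsub] at h1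
  have h2 := Nat.choose_succ_right_eq R i
  have h3 : (R - i) * ((i + 1) * B).choose B ≤ (i + 1) * (N - i * B).choose B := calc
    _ ≤ (R - i + 1) * ((i + 1) * B).choose B := by gcongr; omega
    _ ≤ (i + 1) * ((R - i + 1) * B).choose B :=
      mul_choose_mul_le_mul_choose_mul hB (by omega)
    _ ≤ _ := by
      gcongr
      apply Nat.le_sub_of_add_le
      rw [← add_mul]
      convert hN using 2
      omega
  have hpos : 0 < (i + 1) * ((i + 1) * B).choose B :=
    Nat.mul_pos i.succ_pos (Nat.choose_pos (Nat.le_mul_of_pos_left _ i.succ_pos))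
  refine Nat.le_of_mul_le_mul_right ?_ hpos
  calc
    _ = R.choose (i + 1) * (i + 1) * (N.choose (i * B) * ((i + 1) * B).choose B) := by ring
    _ = R.choose i * N.choose (i * B) * ((R - i) * ((i + 1) * B).choose B) := by
      rw [h2]; ring
    _ ≤ R.choose i * N.choose (i * B) * ((i + 1) * (N - i * B).choose B) := by gcongr
    _ = R.choose i * (i + 1) * (N.choose (i * B) * (N - i * B).choose B) := by ring
    _ = _ := by rw [← h1]; ring

theorem choose_mul_choose_le_of_two_mul_le {R B N i : ℕ} (hB : B ≠ 0) (hi1 : 1 ≤ i)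
    (hi : 2 * i ≤ R) (hN : (R + 1) * B ≤ N) :
    R.choose i * N.choose B ≤ R * N.choose (i * B) := by
  induction i, hi1 using Nat.le_induction with
  | base => simp
  | succ i _ ih =>
    have hiN : i * B ≤ N := (Nat.mul_le_mul_right B (by omega)).trans hN
    refine Nat.le_of_mul_le_mul_right ?_ (Nat.choose_pos hiN)
    calc
      _ = R.choose (i + 1) * N.choose (i * B) * N.choose B := by ring
      _ ≤ R.choose i * N.choose ((i + 1) * B) * N.choose B :=
        Nat.mul_le_mul_right _ (choose_succ_mul_choose_le hB (by omega) hN)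
      _ = R.choose i * N.choose B * N.choose ((i + 1) * B) := by ring
      _ ≤ R * N.choose (i * B) * N.choose ((i + 1) * B) :=
        Nat.mul_le_mul_right _ (ih (by omega))
      _ = _ := by ring

theorem choose_mul_choose_le {R B N i : ℕ} (hB : B ≠ 0) (hi1 : 1 ≤ i) (hiR : i ≤ R)
    (hN : (R + 1) * B ≤ N) :
    R.choose i * N.choose B ≤ R * N.choose (i * B) := by
  rcases le_total (2 * i) R with h | h
  · exact choose_mul_choose_le_of_two_mul_le hB hi1 h hN
  rcases hiR.eq_or_lt with rfl | hlt
  · rw [Nat.choose_self]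
    refine Nat.mul_le_mul hi1 (choose_le_choose_of_add_le (Nat.le_mul_of_pos_left B hi1) ?_)
    linarith
  · rw [← Nat.choose_symm hiR]
    refine (choose_mul_choose_le_of_two_mul_le hB (by omega) (by omega) hN).trans ?_
    refine Nat.mul_le_mul_left _ (choose_le_choose_of_add_le ?_ ?_)
    · exact Nat.mul_le_mul_right _ (by omega)
    · rw [← add_mul, Nat.sub_add_cancel hiR]
      linarith

/-- **Claim 1.** For `1 ≤ i ≤ R`, `1 ≤ B`, and `B ≤ T`, the
server's success probability is bounded:
`C(R, i) / C(R·B + T, i·B) ≤ R / C(R·B + T, B)` in `ℚ`; equivalently,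
`C(R, i) · C(R·B + T, B) ≤ R · C(R·B + T, i·B)`. -/
theorem fusion_claim1 (R B T i : ℕ) (hi1 : 1 ≤ i) (hiR : i ≤ R) (hB : 1 ≤ B)
    (hBT : B ≤ T) :
    (Nat.choose R i : ℚ) / (Nat.choose (R * B + T) (i * B) : ℚ) ≤
        (R : ℚ) / (Nat.choose (R * B + T) B : ℚ) ∧
      Nat.choose R i * Nat.choose (R * B + T) B ≤
        R * Nat.choose (R * B + T) (i * B) := by
  have key : R.choose i * (R * B + T).choose B ≤ R * (R * B + T).choose (i * B) :=
    choose_mul_choose_le (by omega) hi1 hiR (by linarith)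
  refine ⟨?_, key⟩
  have hiB : i * B ≤ R * B + T := (Nat.mul_le_mul_right B hiR).trans (Nat.le_add_right _ _)
  have h1 : (0 : ℚ) < (R * B + T).choose (i * B) := by exact_mod_cast Nat.choose_pos hiB
  have h2 : (0 : ℚ) < (R * B + T).choose B := by
    exact_mod_cast Nat.choose_pos (hBT.trans (Nat.le_add_left _ _))
  rw [div_le_div_iff₀ h1 h2]
  exact_mod_cast key
end

section
/- (Claim 2) Let R, B, T, λ be natural numbers with 1 ≤ B and B ≤ T, and suppose the parameters satisfy the search protocol's constraint R / C(R·B + T, B) ≤ 2^{−λ} (as rationals). Then for every natural number i with 1 ≤ i ≤ R, the server's cheating success probability satisfies C(R, i) / C(R·B + T, i·B) ≤ 2^{−λ}; consequently, a cheating server is detected by the client with probability at least 1 − 2^{−λ}. -/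
theorem Nat.choose_mul_choose_le_mul_choose_mul (B k m : ℕ) (hB : 1 ≤ B) (hm : k + 1 ≤ m) :
    m.choose k * ((k + 1) * B).choose B ≤ (k + 1) * (m * B).choose (k * B) := by
  induction m, hm using Nat.le_induction with
  | base =>
    rw [Nat.choose_succ_self_right,
      Nat.choose_symm_of_eq_add (show (k + 1) * B = B + k * B by ring)]
  | succ m hm ih =>
    obtain ⟨d, rfl⟩ := Nat.exists_eq_add_of_le hm
    obtain ⟨b, rfl⟩ := Nat.exists_eq_add_of_le' hB
    have step : (k + 1 + d + 1) * ((k + 1 + d) * (b + 1)).choose (k * (b + 1)) ≤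
        ((k + 1 + d + 1) * (b + 1)).choose (k * (b + 1)) * (d + 2) := by
      have mono : ((k + 1 + d) * (b + 1)).choose (k * (b + 1)) ≤
          ((k + 1 + d) * (b + 1) + b).choose (k * (b + 1)) :=
        Nat.choose_le_choose _ (Nat.le_add_right _ _)
      have absorb := Nat.choose_mul_succ_eq ((k + 1 + d) * (b + 1) + b) (k * (b + 1))
      have hsub : (k + 1 + d) * (b + 1) + b + 1 - k * (b + 1) = (d + 2) * (b + 1) := by
        apply Nat.sub_eq_of_eq_add
        ring
      rw [hsub, show (k + 1 + d) * (b + 1) + b + 1 = (k + 1 + d + 1) * (b + 1) by ring] at absorb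
      refine Nat.le_of_mul_le_mul_right (c := b + 1) ?_ (Nat.succ_pos b)
      nlinarith [Nat.mul_le_mul_right ((k + 1 + d + 1) * (b + 1)) mono]
    have pascal := Nat.choose_mul_succ_eq (k + 1 + d) k
    rw [show k + 1 + d + 1 - k = d + 2 by omega] at pascal
    refine Nat.le_of_mul_le_mul_right (c := d + 2) ?_ (by omega)
    calc (k + 1 + d + 1).choose k * ((k + 1) * (b + 1)).choose (b + 1) * (d + 2)
        = (k + 1 + d + 1) * ((k + 1 + d).choose k * ((k + 1) * (b + 1)).choose (b + 1)) := by
          rw [mul_right_comm, ← pascal]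
          ring
      _ ≤ (k + 1 + d + 1) * ((k + 1) * ((k + 1 + d) * (b + 1)).choose (k * (b + 1))) :=
          Nat.mul_le_mul_left _ ih
      _ = (k + 1) * ((k + 1 + d + 1) * ((k + 1 + d) * (b + 1)).choose (k * (b + 1))) := by ring
      _ ≤ (k + 1) * (((k + 1 + d + 1) * (b + 1)).choose (k * (b + 1)) * (d + 2)) :=
          Nat.mul_le_mul_left _ step
      _ = _ := by ring

theorem Nat.choose_mul_choose_add_le_mul_choose_mul (R B T i : ℕ) (hB : 1 ≤ B) (hBT : B ≤ T)
    (hi : 1 ≤ i) (hiR : i ≤ R) :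
    R.choose i * (R * B + T).choose B ≤ R * (R * B + T).choose (i * B) := by
  obtain ⟨k, rfl⟩ := Nat.exists_eq_add_of_le' hi
  obtain ⟨n, rfl⟩ := Nat.exists_eq_add_of_le' (hi.trans hiR)
  set N := (n + 1) * B + T with hN
  set Q := ((k + 1) * B).choose B with hQ
  have hBk : B ≤ (k + 1) * B := Nat.le_mul_of_pos_left B (Nat.succ_pos k)
  have hQ_pos : 0 < Q := Nat.choose_pos hBk
  have subsets : N.choose ((k + 1) * B) * Q = N.choose B * (n * B + T).choose (k * B) := by
    rw [hQ, Nat.choose_mul hBk, show N - B = n * B + T by rw [hN]; apply Nat.sub_eq_of_eq_add; ring,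
      show (k + 1) * B - B = k * B by apply Nat.sub_eq_of_eq_add; ring]
  have block : n.choose k * Q ≤ (k + 1) * (n * B + T).choose (k * B) :=
    calc n.choose k * Q ≤ (n + 1).choose k * Q :=
          Nat.mul_le_mul_right _ (Nat.choose_le_choose _ (Nat.le_succ n))
      _ ≤ (k + 1) * ((n + 1) * B).choose (k * B) :=
          Nat.choose_mul_choose_le_mul_choose_mul B k (n + 1) hB hiR
      _ ≤ _ := Nat.mul_le_mul_left _ (Nat.choose_le_choose _ (by linarith))
  have absorb := Nat.add_one_mul_choose_eq n k
  refine Nat.le_of_mul_le_mul_right (c := (k + 1) * Q) ?_ (by positivity)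
  calc (n + 1).choose (k + 1) * N.choose B * ((k + 1) * Q)
      = (n + 1) * N.choose B * (n.choose k * Q) := by
        rw [show (n + 1).choose (k + 1) * N.choose B * ((k + 1) * Q) =
          (n + 1).choose (k + 1) * (k + 1) * (N.choose B * Q) by ring, ← absorb]
        ring
    _ ≤ (n + 1) * N.choose B * ((k + 1) * (n * B + T).choose (k * B)) :=
        Nat.mul_le_mul_left _ block
    _ = (n + 1) * (k + 1) * (N.choose B * (n * B + T).choose (k * B)) := by ring
    _ = _ := by rw [← subsets]; ring

/-- **Claim 2.** If the parameters chosen by the search protocol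
satisfy `R / C(R·B + T, B) ≤ 2^{−λ}` (in `ℚ`), with `1 ≤ B ≤ T`, then for every
`i` with `1 ≤ i ≤ R` the server's cheating success probability satisfies
`C(R, i) / C(R·B + T, i·B) ≤ 2^{−λ}`; consequently a cheating server is
detected with probability at least `1 − 2^{−λ}`. -/
theorem fusion_claim2 (R B T lambda : ℕ) (hB : 1 ≤ B) (hBT : B ≤ T)
    (hsearch : (R : ℚ) / (Nat.choose (R * B + T) B : ℚ) ≤ (1 / 2 : ℚ) ^ lambda) :
    ∀ i : ℕ, 1 ≤ i → i ≤ R →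
      (Nat.choose R i : ℚ) / (Nat.choose (R * B + T) (i * B) : ℚ) ≤
          (1 / 2 : ℚ) ^ lambda ∧
        1 - (1 / 2 : ℚ) ^ lambda ≤
          1 - (Nat.choose R i : ℚ) / (Nat.choose (R * B + T) (i * B) : ℚ) := by
  intro i hi hiR
  have main : (R.choose i : ℚ) / ((R * B + T).choose (i * B) : ℚ) ≤ (1 / 2 : ℚ) ^ lambda := by
    refine le_trans ?_ hsearch
    have hBN : B ≤ R * B + T := hBT.trans (Nat.le_add_left _ _)
    have hiN : i * B ≤ R * B + T := (Nat.mul_le_mul_right B hiR).trans (Nat.le_add_right _ _)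
    rw [div_le_div_iff₀ (by exact_mod_cast Nat.choose_pos hiN)
      (by exact_mod_cast Nat.choose_pos hBN)]
    exact_mod_cast Nat.choose_mul_choose_add_le_mul_choose_mul R B T i hB hBT hi hiR
  exact ⟨main, sub_le_sub_left main 1⟩
end
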